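/- arXiv:1702.07390 — 6 statements merged into one kernel-verified Lean document; each statement's English description precedes it below -/
import Mathlib

section
/- In the single planted model with c = ⌈α₁·ln n⌉, for every fixed α₁ > 0 and every ρ ∈ (0,1] there exists N such that for all n ≥ N and all pairs of distinct vertices x, y (whether or not they lie in the same block), the expected number of triangles containing the edge (x,y) satisfies T(x,y) = Σ_{z ∈ V, z ∉ {x,y}} p(x,z)·p(y,z) < 1. -/
open Finset

theorem aux_block_card (n c k : ℕ) (hc : 0 < c) :
    ((Finset.univ : Finset (Fin n)).filter (fun z : Fin n => k = (z : ℕ) / c)).card ≤ c := by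
  have h : (((Finset.univ : Finset (Fin n)).filter (fun z : Fin n => k = (z : ℕ) / c)).image
      (fun z : Fin n => (z : ℕ))) ⊆ Finset.Ico (k * c) (k * c + c) := by
    intro m hm
    simp only [Finset.mem_image, Finset.mem_filter, Finset.mem_univ, true_and] at hm
    obtain ⟨z, hz, rfl⟩ := hm
    have h1 := Nat.div_add_mod (z : ℕ) c
    have h2 := Nat.mod_lt (z : ℕ) hc
    rw [← hz, mul_comm] at h1
    rw [Finset.mem_Ico]
    omega
  have h3 := Finset.card_le_card h
  rw [Finset.card_image_of_injective _ Fin.val_injective] at h3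
  simpa using h3

theorem aux_eventually (α : ℝ) (hα : 0 < α) :
    ∃ N : ℕ, ∀ n : ℕ, N ≤ n → 1 ≤ Real.log n ∧
      (α * Real.log n + 1) * (2 * Real.log n + Real.log n ^ 2) < n := by
  have h1 : Filter.Tendsto (fun n : ℕ => Real.log (n : ℝ)) Filter.atTop Filter.atTop :=
    Real.tendsto_log_atTop.comp tendsto_natCast_atTop_atTop
  have h2 := (Real.isLittleO_pow_log_id_atTop (n := 3)).comp_tendsto
    (tendsto_natCast_atTop_atTop (R := ℝ))
  have hk : (0 : ℝ) < 1 / (4 * (α + 1)) := by positivity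
  have h3 := h2.def hk
  have h4 := (h1.eventually_ge_atTop 1).and (h3.and (Filter.eventually_ge_atTop 1))
  obtain ⟨N, hN⟩ := Filter.eventually_atTop.1 h4
  refine ⟨N, fun n hn => ?_⟩
  obtain ⟨hL, hb, hn1⟩ := hN n hn
  refine ⟨hL, ?_⟩
  have hn1' : (1 : ℝ) ≤ n := by exact_mod_cast hn1
  simp only [Function.comp, id, Real.norm_eq_abs] at hb
  generalize Real.log (n : ℝ) = L at *
  rw [abs_of_nonneg (by positivity), abs_of_nonneg (by positivity), one_div,
    inv_mul_eq_div, le_div_iff₀ (by positivity)] at hb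
  have e1 : α * L + 1 ≤ (α + 1) * L := by nlinarith
  have e2 : 2 * L + L ^ 2 ≤ 3 * L ^ 2 := by nlinarith
  have e3 : (α * L + 1) * (2 * L + L ^ 2) ≤ ((α + 1) * L) * (3 * L ^ 2) := by
    apply mul_le_mul e1 e2 <;> positivity
  have e4 : 0 < L ^ 3 * (α + 1) := by positivity
  nlinarith

/-- **Single planted model, triangles.** Vertex set `Fin n`, blocks `β v = v / c` with
`c = ⌈α₁ · ln n⌉`, within-block edge probability `ρ / √c`, cross-block probability `ln n / n`.
For every `α₁ > 0` and `ρ ∈ (0,1]` there is `N` such that for all `n ≥ N` and all distinct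
vertices `x, y`, the expected number of triangles containing the edge `(x,y)` is `< 1`. -/
theorem single_planted_triangles_lt_one
    (α₁ : ℝ) (hα₁ : 0 < α₁) (ρ : ℝ) (hρ0 : 0 < ρ) (hρ1 : ρ ≤ 1) :
    ∃ N : ℕ, ∀ n : ℕ, N ≤ n → ∀ x y : Fin n, x ≠ y →
      let c : ℕ := ⌈α₁ * Real.log n⌉₊
      let p : Fin n → Fin n → ℝ := fun u v =>
        if (u : ℕ) / c = (v : ℕ) / c then ρ / Real.sqrt c else Real.log n / n
      (∑ z ∈ Finset.univ \ {x, y}, p x z * p y z) < 1 := by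
  obtain ⟨N, hN⟩ := aux_eventually α₁ hα₁
  refine ⟨N, fun n hn x y hxy => ?_⟩
  obtain ⟨hL, hlt⟩ := hN n hn
  intro c p
  have hcα : (c : ℝ) < α₁ * Real.log n + 1 := Nat.ceil_lt_add_one (by positivity)
  have hc : 0 < c := Nat.ceil_pos.2 (by positivity)
  have hp : ∀ u v, p u v = if (u : ℕ) / c = (v : ℕ) / c then ρ / Real.sqrt c
    else Real.log n / n := fun _ _ => rfl
  clear_value p c
  have hn0 : (0 : ℝ) < n := by
    have : 0 < n := x.pos
    exact_mod_cast this
  generalize Real.log (n : ℝ) = L at *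
  have hc1 : (1 : ℝ) ≤ c := by exact_mod_cast hc
  have hcL : (c : ℝ) * (2 * L + L ^ 2) < n := by
    refine lt_of_le_of_lt ?_ hlt
    apply mul_le_mul_of_nonneg_right hcα.le
    positivity
  have hs1 : 1 ≤ Real.sqrt c := Real.one_le_sqrt.2 hc1
  have hq1 : ρ / Real.sqrt c ≤ 1 := by
    rw [div_le_one (by positivity)]; linarith
  have hq0 : 0 < ρ / Real.sqrt c := by positivity
  have hqq : ρ / Real.sqrt c * (ρ / Real.sqrt c) ≤ 1 / c := by
    rw [div_mul_div_comm, Real.mul_self_sqrt (by positivity)]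
    apply div_le_div_of_nonneg_right _ (by positivity)
    nlinarith
  have hr0 : 0 < L / n := by positivity
  generalize ρ / Real.sqrt c = q at *
  have hnr : (n : ℝ) * (L / n * (L / n)) = L ^ 2 / n := by field_simp
  generalize hr : L / (n : ℝ) = r at *
  have hsub : ∀ k : ℕ, (((Finset.univ \ {x, y} : Finset (Fin n)).filter
      (fun z : Fin n => k = (z : ℕ) / c)).card : ℝ) ≤ c := by
    intro k
    have := (Finset.card_le_card (Finset.filter_subset_filter
      (fun z : Fin n => k = (z : ℕ) / c)
      (Finset.sdiff_subset (s := Finset.univ) (t := {x, y})))).trans (aux_block_card n c k hc)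
    exact_mod_cast this
  have hcard : ((Finset.univ \ {x, y} : Finset (Fin n)).card : ℝ) ≤ n := by
    have := Finset.card_le_univ (Finset.univ \ {x, y} : Finset (Fin n))
    rw [Fintype.card_fin] at this
    exact_mod_cast this
  have hrr : 0 ≤ r * r := by positivity
  by_cases hb : (x : ℕ) / c = (y : ℕ) / c
  · have hle : ∀ z ∈ (Finset.univ \ {x, y} : Finset (Fin n)), p x z * p y z ≤
        (if (x : ℕ) / c = (z : ℕ) / c then 1 / (c : ℝ) else 0) + r * r := by
      intro z _
      rw [hp, hp, ← hb]
      split_ifs <;> linarith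
    refine lt_of_le_of_lt (Finset.sum_le_sum hle) ?_
    rw [Finset.sum_add_distrib, Finset.sum_const, ← Finset.sum_filter, Finset.sum_const,
      nsmul_eq_mul, nsmul_eq_mul]
    have h2 : (((Finset.univ \ {x, y} : Finset (Fin n)).filter
      (fun z : Fin n => (x : ℕ) / c = (z : ℕ) / c)).card : ℝ) + 1 ≤ c := by
      have hss : (Finset.univ \ {x, y} : Finset (Fin n)).filter
          (fun z : Fin n => (x : ℕ) / c = (z : ℕ) / c) ⊂ (Finset.univ : Finset (Fin n)).filter
          (fun z : Fin n => (x : ℕ) / c = (z : ℕ) / c) := by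
        rw [Finset.ssubset_iff_of_subset (Finset.filter_subset_filter _ Finset.sdiff_subset)]
        exact ⟨x, by simp, by simp⟩
      have := (Finset.card_lt_card hss).trans_le (aux_block_card n c _ hc)
      exact_mod_cast this
    have h3 := mul_le_mul_of_nonneg_right hcard hrr
    have h4 : L ^ 2 / n < 1 / c := by
      rw [div_lt_div_iff₀ hn0 (by positivity)]
      nlinarith
    have h5 : (((Finset.univ \ {x, y} : Finset (Fin n)).filter
      (fun z : Fin n => (x : ℕ) / c = (z : ℕ) / c)).card : ℝ) * (1 / c) ≤ (c - 1) * (1 / c) :=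
      mul_le_mul_of_nonneg_right (by linarith) (by positivity)
    have h6 : ((c : ℝ) - 1) * (1 / c) = 1 - 1 / c := by field_simp
    linarith
  · have hqr : 0 ≤ r := hr0.le
    have hle : ∀ z ∈ (Finset.univ \ {x, y} : Finset (Fin n)), p x z * p y z ≤
        (if (x : ℕ) / c = (z : ℕ) / c then r else 0) +
        (if (y : ℕ) / c = (z : ℕ) / c then r else 0) + r * r := by
      intro z _
      rw [hp, hp]
      split_ifs with h1 h2
      · exact absurd (h1.trans h2.symm) hb
      all_goals nlinarith
    refine lt_of_le_of_lt (Finset.sum_le_sum hle) ?_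
    rw [Finset.sum_add_distrib, Finset.sum_add_distrib, Finset.sum_const, ← Finset.sum_filter,
      ← Finset.sum_filter, Finset.sum_const, Finset.sum_const,
      nsmul_eq_mul, nsmul_eq_mul, nsmul_eq_mul]
    have h3 := mul_le_mul_of_nonneg_right hcard hrr
    have h4 := mul_le_mul_of_nonneg_right (hsub ((x : ℕ) / c)) hqr
    have h5 := mul_le_mul_of_nonneg_right (hsub ((y : ℕ) / c)) hqr
    have h6 : c * r + c * r + L ^ 2 / n < 1 := by
      rw [← hr]
      have : (c : ℝ) * (L / n) + c * (L / n) + L ^ 2 / n = (2 * c * L + L ^ 2) / n := by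
        field_simp; ring
      rw [this, div_lt_one hn0]
      nlinarith [sq_nonneg L]
    linarith
end

section
/- In the single planted model with c = ⌈α₁·ln n⌉, for every fixed α₁ > 0 and every ρ ∈ (0,1] there exists N such that for all n ≥ N and all distinct vertices x, y lying in different blocks (β(x) ≠ β(y)), the expected number of squares containing the edge (x,y) satisfies S(x,y) = Σ_{(u,v) ordered pairs of distinct vertices with u,v ∉ {x,y}} p(x,u)·p(u,v)·p(v,y) < 1. -/
open Finset

lemma aux_block (n c k : ℕ) (hc : 0 < c) :
    (∑ b : Fin n, if k = (b : ℕ) / c then (1 : ℝ) else 0) ≤ c := by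
  rw [Finset.sum_boole]
  have h : (Finset.univ.filter (fun b : Fin n => k = (b : ℕ) / c)).card
      ≤ (Finset.range c).card := by
    apply Finset.card_le_card_of_injOn (fun b : Fin n => (b : ℕ) % c)
    · intro b _
      simpa using Nat.mod_lt _ hc
    · intro a ha b hb hab
      simp only [Finset.coe_filter, Finset.mem_univ, true_and, Set.mem_ofPred_eq] at ha hb
      simp only at hab
      apply Fin.ext
      rw [← Nat.div_add_mod (a : ℕ) c, ← Nat.div_add_mod (b : ℕ) c, ← ha, ← hb, hab]
  rw [Finset.card_range] at h
  exact_mod_cast h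

lemma aux_sum {n : ℕ} (I : Fin n → Fin n → ℝ) (c q r : ℝ) (hc : 0 ≤ c) (hq : 0 ≤ q) (hr : 0 ≤ r)
    (hI : ∀ a b, 0 ≤ I a b) (hs : ∀ a b, I a b = I b a) (hb : ∀ a, ∑ b, I a b ≤ c)
    (x y : Fin n) :
    ∑ u, ∑ v, (q ^ 2 * r * (I x u * I u v + I x u * I v y + I u v * I v y)
      + q * r ^ 2 * (I x u + I u v + I v y) + r ^ 3)
      ≤ q ^ 2 * r * (3 * c ^ 2) + q * r ^ 2 * (3 * (n * c)) + n ^ 2 * r ^ 3 := by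
  have hb' : ∀ a, ∑ b, I b a ≤ c := fun a => by
    simpa only [hs] using (Finset.sum_congr rfl (fun b _ => hs b a)).trans_le (hb a)
  have e1 : ∑ u, ∑ v, I x u * I u v ≤ c ^ 2 := by
    calc _ ≤ ∑ u, I x u * c := by
          refine Finset.sum_le_sum fun u _ => ?_
          rw [← Finset.mul_sum]
          exact mul_le_mul_of_nonneg_left (hb u) (hI _ _)
      _ ≤ c * c := by
          rw [← Finset.sum_mul]
          exact mul_le_mul_of_nonneg_right (hb x) hc
      _ = _ := by ring
  have e2 : ∑ u, ∑ v, I x u * I v y ≤ c ^ 2 := by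
    rw [← Finset.sum_mul_sum, sq]
    exact mul_le_mul (hb x) (hb' y) (Finset.sum_nonneg fun _ _ => hI _ _) hc
  have e3 : ∑ u, ∑ v, I u v * I v y ≤ c ^ 2 := by
    rw [Finset.sum_comm]
    calc _ ≤ ∑ v, c * I v y := by
          refine Finset.sum_le_sum fun u _ => ?_
          rw [← Finset.sum_mul]
          exact mul_le_mul_of_nonneg_right (hb' u) (hI _ _)
      _ ≤ c * c := by
          rw [← Finset.mul_sum]
          exact mul_le_mul_of_nonneg_left (hb' y) hc
      _ = _ := by ring
  have f1 : ∑ u, ∑ _v : Fin n, I x u ≤ n * c := by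
    simp only [Finset.sum_const, Finset.card_univ, Fintype.card_fin, nsmul_eq_mul]
    rw [← Finset.mul_sum]
    exact mul_le_mul_of_nonneg_left (hb x) (Nat.cast_nonneg _)
  have f2 : ∑ u, ∑ v, I u v ≤ n * c := by
    calc _ ≤ ∑ _u : Fin n, c := Finset.sum_le_sum fun u _ => hb u
      _ = _ := by simp
  have f3 : ∑ _u : Fin n, ∑ v, I v y ≤ n * c := by
    calc _ ≤ ∑ _u : Fin n, c := Finset.sum_le_sum fun u _ => hb' y
      _ = _ := by simp
  have key : ∑ u, ∑ v, (q ^ 2 * r * (I x u * I u v + I x u * I v y + I u v * I v y)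
      + q * r ^ 2 * (I x u + I u v + I v y) + r ^ 3)
      = q ^ 2 * r * (∑ u, ∑ v, I x u * I u v + ∑ u, ∑ v, I x u * I v y
          + ∑ u, ∑ v, I u v * I v y)
        + q * r ^ 2 * (∑ u, ∑ _v : Fin n, I x u + ∑ u, ∑ v, I u v
          + ∑ _u : Fin n, ∑ v, I v y) + ∑ _u : Fin n, ∑ _v : Fin n, r ^ 3 := by
    simp only [← Finset.sum_add_distrib, Finset.mul_sum]
  have g : ∑ _u : Fin n, ∑ _v : Fin n, r ^ 3 = n ^ 2 * r ^ 3 := by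
    simp; ring
  rw [key, g]
  gcongr
  · linarith
  · linarith

lemma aux_pt (q r : ℝ) (hq : 0 ≤ q) (hr : 0 ≤ r) (A B C : Prop) [Decidable A] [Decidable B]
    [Decidable C] (h : ¬ (A ∧ B ∧ C)) :
    (if A then q else r) * (if B then q else r) * (if C then q else r) ≤
      q ^ 2 * r * ((if A then 1 else 0) * (if B then 1 else 0)
        + (if A then 1 else 0) * (if C then 1 else 0)
        + (if B then 1 else 0) * (if C then 1 else 0))
      + q * r ^ 2 * ((if A then 1 else 0) + (if B then 1 else 0) + (if C then 1 else 0))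
      + r ^ 3 := by
  have m1 : 0 ≤ q ^ 2 * r := by positivity
  have m2 : 0 ≤ q * r ^ 2 := by positivity
  have m3 : 0 ≤ r ^ 3 := by positivity
  by_cases h1 : A <;> by_cases h2 : B <;> by_cases h3 : C
  · exact absurd ⟨h1, h2, h3⟩ h
  all_goals
    simp only [h1, h2, h3, if_true, if_false]
    linarith

lemma aux_lim (α : ℝ) : ∃ N : ℕ, ∀ n : ℕ, N ≤ n →
    3 * (α * Real.log n + 1) * (Real.log n / n) + 3 * (α * Real.log n + 1) * Real.log n ^ 2 / n
      + Real.log n ^ 3 / n < 1 := by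
  have h : ∀ k : ℕ, Filter.Tendsto (fun n : ℕ => Real.log n ^ k / (n : ℝ)) Filter.atTop (nhds 0) :=
    fun k => ((Real.isLittleO_pow_log_id_atTop (n := k)).tendsto_div_nhds_zero).comp
      tendsto_natCast_atTop_atTop
  have t := ((((h 1).const_mul 3).add ((h 2).const_mul (3 * α + 3))).add
    ((h 3).const_mul (3 * α + 1)))
  simp only [mul_zero, add_zero] at t
  obtain ⟨N, hN⟩ := Filter.eventually_atTop.1 (t.eventually (gt_mem_nhds one_pos))
  refine ⟨N, fun n hn => lt_of_eq_of_lt ?_ (hN n hn)⟩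
  ring

/-- **Single planted model, squares through cross-block edges.** Vertex set `Fin n`, blocks
`β v = v / c` with `c = ⌈α₁ · ln n⌉`, within-block edge probability `ρ / √c`, cross-block
probability `ln n / n`. For every `α₁ > 0` and `ρ ∈ (0,1]` there is `N` such that for all
`n ≥ N` and all distinct vertices `x, y` lying in different blocks, the expected number of
squares containing the edge `(x,y)` (summed over ordered pairs `(u,v)` of distinct vertices
avoiding `x, y`) is `< 1`. -/
theorem single_planted_squares_cross_lt_one
    (α₁ : ℝ) (hα₁ : 0 < α₁) (ρ : ℝ) (hρ0 : 0 < ρ) (hρ1 : ρ ≤ 1) :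
    ∃ N : ℕ, ∀ n : ℕ, N ≤ n → ∀ x y : Fin n, x ≠ y →
      let c : ℕ := ⌈α₁ * Real.log n⌉₊
      (x : ℕ) / c ≠ (y : ℕ) / c →
      let p : Fin n → Fin n → ℝ := fun u v =>
        if (u : ℕ) / c = (v : ℕ) / c then ρ / Real.sqrt c else Real.log n / n
      (∑ u ∈ Finset.univ \ {x, y}, ∑ v ∈ (Finset.univ \ {x, y}).erase u,
          p x u * p u v * p v y) < 1 := by
  obtain ⟨N, hN⟩ := aux_lim α₁
  refine ⟨max N 2, fun n hn x y _ => ?_⟩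
  intro c hxy p
  have hn2 : 2 ≤ n := le_trans (le_max_right _ _) hn
  have hlim := hN n (le_trans (le_max_left _ _) hn)
  have hnR : (2 : ℝ) ≤ n := by exact_mod_cast hn2
  have hL : 0 < Real.log n := Real.log_pos (by linarith)
  have hc0 : 0 < c := Nat.ceil_pos.2 (mul_pos hα₁ hL)
  have hc1 : (1 : ℝ) ≤ c := by exact_mod_cast hc0
  have hcu : (c : ℝ) ≤ α₁ * Real.log n + 1 := (Nat.ceil_lt_add_one (mul_pos hα₁ hL).le).le
  set q : ℝ := ρ / Real.sqrt c with hq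
  set r : ℝ := Real.log n / n with hr
  have hs1 : 1 ≤ Real.sqrt c := Real.one_le_sqrt.2 hc1
  have hq0 : 0 ≤ q := by positivity
  have hr0 : 0 ≤ r := by positivity
  have hq1 : q ≤ 1 := by
    rw [hq, div_le_one (by linarith)]; linarith
  have hqc : q ^ 2 * c ≤ 1 := by
    rw [hq, div_pow, Real.sq_sqrt (by linarith), div_mul_cancel₀ _ (by linarith)]
    nlinarith
  let I : Fin n → Fin n → ℝ := fun a b => if (a : ℕ) / c = (b : ℕ) / c then 1 else 0
  have hI : ∀ a b, 0 ≤ I a b := by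
    intro a b; simp only [I]; split_ifs <;> norm_num
  have hp : ∀ a b, 0 ≤ p a b := by
    intro a b; simp only [p]; split_ifs <;> assumption
  have hsym : ∀ a b, I a b = I b a := by
    intro a b; simp only [I, eq_comm]
  have hS := aux_sum I c q r (by linarith) hq0 hr0 hI hsym
    (fun a => aux_block n c _ hc0) x y
  have hpt : ∀ u v, p x u * p u v * p v y ≤
      q ^ 2 * r * (I x u * I u v + I x u * I v y + I u v * I v y)
      + q * r ^ 2 * (I x u + I u v + I v y) + r ^ 3 := by
    intro u v
    exact aux_pt q r hq0 hr0 _ _ _ fun ⟨h1, h2, h3⟩ => hxy (h1.trans (h2.trans h3))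
  have hle : (∑ u ∈ Finset.univ \ {x, y}, ∑ v ∈ (Finset.univ \ {x, y}).erase u,
          p x u * p u v * p v y) ≤ ∑ u, ∑ v, p x u * p u v * p v y := by
    have hnn : ∀ u v, 0 ≤ p x u * p u v * p v y := fun u v =>
      mul_nonneg (mul_nonneg (hp _ _) (hp _ _)) (hp _ _)
    refine (Finset.sum_le_sum fun u _ => Finset.sum_le_sum_of_subset_of_nonneg
      (Finset.subset_univ _) fun v _ _ => hnn u v).trans ?_
    exact Finset.sum_le_sum_of_subset_of_nonneg (Finset.subset_univ _)
      fun u _ _ => Finset.sum_nonneg fun v _ => hnn u v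
  have hle2 := Finset.sum_le_sum fun u (_ : u ∈ Finset.univ) =>
    Finset.sum_le_sum fun v (_ : v ∈ Finset.univ) => hpt u v
  refine (hle.trans (hle2.trans hS)).trans_lt (lt_of_le_of_lt ?_ hlim)
  have hn0 : (n : ℝ) ≠ 0 := by linarith
  have a1 : q ^ 2 * r * (3 * (c : ℝ) ^ 2) ≤ 3 * (α₁ * Real.log n + 1) * r := by
    calc _ = 3 * ((q ^ 2 * c) * c) * r := by ring
      _ ≤ 3 * (1 * (α₁ * Real.log n + 1)) * r := by gcongr
      _ = _ := by ring
  have a2 : q * r ^ 2 * (3 * (n * (c : ℝ))) ≤ 3 * (α₁ * Real.log n + 1) * Real.log n ^ 2 / n := by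
    calc _ = 3 * (q * c) * Real.log n ^ 2 / n := by rw [hr]; field_simp
      _ ≤ 3 * (1 * (α₁ * Real.log n + 1)) * Real.log n ^ 2 / n := by gcongr
      _ = _ := by ring
  have a3 : (n : ℝ) ^ 2 * r ^ 3 = Real.log n ^ 3 / n := by
    rw [hr]; field_simp
  linarith
end

section
/- In the single planted model, if x and y are distinct vertices lying in the same block and that block contains exactly c vertices, then the expected number of squares containing the edge (x,y) satisfies S(x,y) ≥ (1 − 5/c)·√c·ρ³. In particular, restricting the sum to ordered pairs (u,v) of distinct vertices of the same block with u,v ∉ {x,y} already yields S(x,y) ≥ (c−2)(c−3)·(ρ/√c)³ = ((c²−5c+6)/c²)·√c·ρ³ ≥ (1 − 5/c)·√c·ρ³. -/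
open Finset

/-- **Single planted model, squares through a within-block edge.** Vertex set `Fin n`, blocks
`β v = v / c` (with `c ≥ 2`), within-block edge probability `ρ / √c`, cross-block probability
`ln n / n`. If `x ≠ y` lie in the same block and that block contains exactly `c` vertices, then
the expected number of squares `S(x,y)` containing the edge `(x,y)` satisfies both
`S(x,y) ≥ (c−2)(c−3)·(ρ/√c)³` (obtained by restricting to ordered pairs inside the block) and
`S(x,y) ≥ (1 − 5/c)·√c·ρ³`. -/
theorem single_planted_squares_within_ge
    (n c : ℕ) (hc : 2 ≤ c) (ρ : ℝ) (hρ0 : 0 < ρ) (hρ1 : ρ ≤ 1)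
    (x y : Fin n) (hxy : x ≠ y) (hblock : (x : ℕ) / c = (y : ℕ) / c)
    (hsize : (Finset.univ.filter (fun v : Fin n => (v : ℕ) / c = (x : ℕ) / c)).card = c) :
    let p : Fin n → Fin n → ℝ := fun u v =>
      if (u : ℕ) / c = (v : ℕ) / c then ρ / Real.sqrt c else Real.log n / n
    let S : ℝ := ∑ u ∈ Finset.univ \ {x, y}, ∑ v ∈ (Finset.univ \ {x, y}).erase u,
      p x u * p u v * p v y
    S ≥ ((c : ℝ) - 2) * ((c : ℝ) - 3) * (ρ / Real.sqrt c) ^ 3 ∧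
      S ≥ (1 - 5 / (c : ℝ)) * Real.sqrt c * ρ ^ 3 := by
  intro p S
  have hc0 : (0 : ℝ) < c := by
    have : 0 < c := by omega
    exact_mod_cast this
  have hs : 0 < Real.sqrt c := Real.sqrt_pos.mpr hc0
  have hq : 0 < ρ / Real.sqrt c := div_pos hρ0 hs
  have hp : ∀ u v, 0 ≤ p u v := by
    intro u v
    simp only [p]
    split_ifs
    · exact hq.le
    · exact div_nonneg (Real.log_natCast_nonneg n) (Nat.cast_nonneg n)
  have h3 : ∀ u v, 0 ≤ p x u * p u v * p v y := fun u v =>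
    mul_nonneg (mul_nonneg (hp _ _) (hp _ _)) (hp _ _)
  set B : Finset (Fin n) :=
    (Finset.univ.filter (fun v : Fin n => (v : ℕ) / c = (x : ℕ) / c)) \ {x, y} with hB
  have hBs : B ⊆ Finset.univ \ {x, y} := Finset.sdiff_subset_sdiff (Finset.subset_univ _) le_rfl
  have hBm : ∀ u ∈ B, (u : ℕ) / c = (x : ℕ) / c := by
    intro u hu
    simp only [hB, Finset.mem_sdiff, Finset.mem_filter] at hu
    exact hu.1.2
  have hcard : B.card = c - 2 := by
    rw [hB, Finset.card_sdiff_of_subset, hsize, Finset.card_pair hxy]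
    intro v hv
    simp only [Finset.mem_insert, Finset.mem_singleton] at hv
    rcases hv with rfl | rfl <;> simp [hblock]
  have hcardR : (B.card : ℝ) = (c : ℝ) - 2 := by
    rw [hcard, Nat.cast_sub hc]; norm_num
  have hin : ∀ u ∈ B, ∑ v ∈ B.erase u, p x u * p u v * p v y
      = ((c : ℝ) - 3) * (ρ / Real.sqrt c) ^ 3 := by
    intro u hu
    have h1 : ∀ v ∈ B.erase u, p x u * p u v * p v y = (ρ / Real.sqrt c) ^ 3 := by
      intro v hv
      have hu' := hBm u hu
      have hv' := hBm v (Finset.mem_of_mem_erase hv)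
      simp only [p]
      rw [if_pos hu'.symm, if_pos (hu'.trans hv'.symm), if_pos (hv'.trans hblock)]
      ring
    rw [Finset.sum_congr rfl h1, Finset.sum_const, nsmul_eq_mul]
    have h2 := Finset.card_erase_add_one hu
    have h2' : ((B.erase u).card : ℝ) + 1 = B.card := by exact_mod_cast h2
    rw [show ((B.erase u).card : ℝ) = (c : ℝ) - 3 by linarith]
  have hS : S ≥ ((c : ℝ) - 2) * ((c : ℝ) - 3) * (ρ / Real.sqrt c) ^ 3 := by
    calc ((c : ℝ) - 2) * ((c : ℝ) - 3) * (ρ / Real.sqrt c) ^ 3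
        = ∑ u ∈ B, ∑ v ∈ B.erase u, p x u * p u v * p v y := by
          rw [Finset.sum_congr rfl hin, Finset.sum_const, nsmul_eq_mul, hcardR]
          ring
      _ ≤ ∑ u ∈ B, ∑ v ∈ (Finset.univ \ {x, y}).erase u, p x u * p u v * p v y :=
          Finset.sum_le_sum fun u _ => Finset.sum_le_sum_of_subset_of_nonneg
            (Finset.erase_subset_erase u hBs) fun v _ _ => h3 u v
      _ ≤ S := Finset.sum_le_sum_of_subset_of_nonneg hBs
            fun u _ _ => Finset.sum_nonneg fun v _ => h3 u v
  refine ⟨hS, le_trans ?_ hS⟩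
  have hsq : Real.sqrt c ^ 2 = c := Real.sq_sqrt hc0.le
  clear_value S p B
  generalize Real.sqrt c = s at *
  have e : ((c : ℝ) - 2) * ((c : ℝ) - 3) * (ρ / s) ^ 3
      = (1 - 5 / (c : ℝ)) * s * ρ ^ 3 + 6 * (ρ / s) ^ 3 := by
    rw [← hsq]
    field_simp
    ring
  rw [e]
  have : 0 ≤ (ρ / s) ^ 3 := by positivity
  linarith
end

section
/- For every real x with 0 < x < 1 and every integer c ≥ 4 such that (c−3)·x·(1−x²) ≥ 1, one has 1 − (1−x³)^{(c−2)(c−3)} ≥ 1 − (1−x²)^{c−2}; equivalently, (1−x³)^{(c−2)(c−3)} ≤ (1−x²)^{c−2}. -/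
/-- For `0 < x < 1` and an integer `c ≥ 4` with `(c−3)·x·(1−x²) ≥ 1`, the probability that a
within-community edge lies in a square, `1 − (1−x³)^{(c−2)(c−3)}`, is at least the probability
that it lies in a triangle, `1 − (1−x²)^{c−2}`. -/
theorem square_prob_ge_triangle_prob
    (x : ℝ) (hx0 : 0 < x) (hx1 : x < 1) (c : ℕ) (hc : 4 ≤ c)
    (h : ((c : ℝ) - 3) * x * (1 - x ^ 2) ≥ 1) :
    1 - (1 - x ^ 3) ^ ((c - 2) * (c - 3)) ≥ 1 - (1 - x ^ 2) ^ (c - 2) := by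
  obtain ⟨m, rfl⟩ : ∃ m, c = m + 3 := ⟨c - 3, by omega⟩
  have e2 : m + 3 - 3 = m := by omega
  rw [e2]
  push_cast at h
  have h' : (m : ℝ) * x * (1 - x ^ 2) ≥ 1 := by
    have e : (m : ℝ) + 3 - 3 = m := by ring
    rwa [e] at h
  have hx3 : 0 < x ^ 3 := by positivity
  have hx3' : x ^ 3 < 1 := pow_lt_one₀ hx0.le hx1 (by norm_num)
  have hm : (0 : ℝ) ≤ m := Nat.cast_nonneg m
  have hP : 0 ≤ (1 - x ^ 3) ^ m := pow_nonneg (by linarith) m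
  have hB : 1 + (m : ℝ) * x ^ 3 ≤ (1 + x ^ 3) ^ m :=
    one_add_mul_le_pow (by linarith) m
  have h1 : (1 - x ^ 3) ^ m * (1 + x ^ 3) ^ m ≤ 1 := by
    rw [← mul_pow]
    apply pow_le_one₀ <;> nlinarith
  have h2 : (1 - x ^ 3) ^ m * (1 + m * x ^ 3) ≤ 1 :=
    (mul_le_mul_of_nonneg_left hB hP).trans h1
  have h3 : 1 ≤ (1 - x ^ 2) * (1 + m * x ^ 3) := by
    nlinarith [mul_le_mul_of_nonneg_left h' (sq_nonneg x)]
  have hpos : 0 < 1 + (m : ℝ) * x ^ 3 := by positivity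
  have key : (1 - x ^ 3) ^ m ≤ 1 - x ^ 2 :=
    le_of_mul_le_mul_right (h2.trans h3) hpos
  have hfin := pow_le_pow_left₀ hP key (m + 3 - 2)
  rw [← pow_mul, mul_comm m] at hfin
  linarith
end

section
/- For every α₁ > 0 and every ρ ∈ (0,1) there exists N such that for all n ≥ N, with c = α₁·ln n, one has (n−2)·[ (c/n)·(ρ/√c)² + 2·(c/n)·((n−c)/n)·(ρ/√c)·((ln n)/n) + ((n−c)/n)·((n−2c)/n)·((ln n)/n)² ] < 1. -/
/-- **Double planted model, triangle bound: endpoints sharing exactly one group.** For every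
`α₁ > 0` and `ρ ∈ (0,1)` there is `N` such that for all `n ≥ N`, with `c = α₁ · ln n`,
`(n−2)·[(c/n)·(ρ/√c)² + 2·(c/n)·((n−c)/n)·(ρ/√c)·((ln n)/n) + ((n−c)/n)·((n−2c)/n)·((ln n)/n)²] < 1`. -/
theorem double_planted_triangle_same_group
    (α₁ : ℝ) (hα₁ : 0 < α₁) (ρ : ℝ) (hρ0 : 0 < ρ) (hρ1 : ρ < 1) :
    ∃ N : ℕ, ∀ n : ℕ, N ≤ n →
      let c : ℝ := α₁ * Real.log n
      ((n : ℝ) - 2) *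
        ((c / n) * (ρ / Real.sqrt c) ^ 2 +
          2 * (c / n) * (((n : ℝ) - c) / n) * (ρ / Real.sqrt c) * (Real.log n / n) +
          (((n : ℝ) - c) / n) * (((n : ℝ) - 2 * c) / n) * (Real.log n / n) ^ 2) < 1 := by
  have hlog : Filter.Tendsto (fun n : ℕ => Real.log n) Filter.atTop Filter.atTop :=
    Real.tendsto_log_atTop.comp tendsto_natCast_atTop_atTop
  have h2 : Filter.Tendsto (fun n : ℕ => Real.log n ^ 2 / (n : ℝ)) Filter.atTop (nhds 0) := by
    have := (Real.tendsto_pow_log_div_mul_add_atTop 1 0 2 one_ne_zero).comp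
      (tendsto_natCast_atTop_atTop (R := ℝ))
    simpa [Function.comp_def] using this
  have h1 : Filter.Tendsto (fun n : ℕ => Real.log n / (n : ℝ)) Filter.atTop (nhds 0) := by
    have := (Real.tendsto_pow_log_div_mul_add_atTop 1 0 1 one_ne_zero).comp
      (tendsto_natCast_atTop_atTop (R := ℝ))
    simpa [Function.comp_def] using this
  have hε : 0 < (1 - ρ ^ 2) / (2 * α₁ + 1) := by
    apply div_pos
    · nlinarith
    · linarith
  have hδ : 0 < 1 / (2 * α₁) := by positivity
  obtain ⟨N, hN⟩ := Filter.eventually_atTop.1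
    (((hlog.eventually_ge_atTop (1 / α₁)).and (h2.eventually_lt_const hε)).and
      ((h1.eventually_lt_const hδ).and (Filter.eventually_ge_atTop 2)))
  refine ⟨N, fun n hn => ?_⟩
  obtain ⟨⟨hL, hE⟩, hD, hn2⟩ := hN n hn
  intro c
  have hx : (2 : ℝ) ≤ n := by exact_mod_cast hn2
  have hcdef : c = α₁ * Real.log n := rfl
  clear_value c
  generalize (n : ℝ) = x at *
  generalize Real.log x = L at *
  have hx0 : 0 < x := by linarith
  have hL0 : 0 < L := lt_of_lt_of_le (by positivity) hL
  have hc1 : 1 ≤ c := by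
    rw [div_le_iff₀ hα₁] at hL
    linarith
  have hc2 : 2 * c ≤ x := by
    rw [div_lt_div_iff₀ hx0 (by positivity)] at hD
    linarith
  have hE' : (2 * α₁ + 1) * (L ^ 2 / x) < 1 - ρ ^ 2 := by
    rw [lt_div_iff₀ (by linarith)] at hE
    linarith
  have hs1 : 1 ≤ Real.sqrt c := Real.one_le_sqrt.2 hc1
  have hs0 : 0 < Real.sqrt c := by linarith
  have ht0 : 0 ≤ ρ / Real.sqrt c := by positivity
  have ht1 : ρ / Real.sqrt c ≤ 1 := by
    rw [div_le_one hs0]; linarith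
  have hA : (c / x) * (ρ / Real.sqrt c) ^ 2 = ρ ^ 2 / x := by
    rw [div_pow, Real.sq_sqrt (by linarith)]
    field_simp
  have hu0 : 0 ≤ (x - c) / x := div_nonneg (by linarith) hx0.le
  have hu1 : (x - c) / x ≤ 1 := by rw [div_le_one hx0]; linarith
  have hv0 : 0 ≤ (x - 2 * c) / x := div_nonneg (by linarith) hx0.le
  have hv1 : (x - 2 * c) / x ≤ 1 := by rw [div_le_one hx0]; linarith
  rw [hA]
  generalize (x - c) / x = u at *
  generalize (x - 2 * c) / x = v at *
  generalize ρ / Real.sqrt c = t at *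
  have hc0 : 0 < c := by linarith
  have hB : 2 * (c / x) * u * t * (L / x) ≤ 2 * (c / x) * 1 * 1 * (L / x) := by gcongr
  have hC : u * v * (L / x) ^ 2 ≤ 1 * 1 * (L / x) ^ 2 := by gcongr
  calc (x - 2) * (ρ ^ 2 / x + 2 * (c / x) * u * t * (L / x) + u * v * (L / x) ^ 2)
      ≤ x * (ρ ^ 2 / x + 2 * (c / x) * u * t * (L / x) + u * v * (L / x) ^ 2) := by
        apply mul_le_mul_of_nonneg_right (by linarith)
        positivity
    _ ≤ x * (ρ ^ 2 / x + 2 * (c / x) * 1 * 1 * (L / x) + 1 * 1 * (L / x) ^ 2) := by gcongr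
    _ = ρ ^ 2 + (2 * α₁ + 1) * (L ^ 2 / x) := by
        rw [hcdef]; field_simp; ring
    _ < 1 := by linarith
end

section
/- Let V be a finite set, let g₁, g₂ : V → I be two assignments of group labels, and let s ≥ 1 be a real number. Say that u shares a group with w if g₁(u) = g₁(w) or g₂(u) = g₂(w). Suppose: (i) every part has size at most s, i.e. |g₁⁻¹(i)| ≤ s and |g₂⁻¹(i)| ≤ s for all i ∈ I; and (ii) |{w ∈ V : g₁(w) = i and g₂(w) = j}| ≤ 3 for all i, j ∈ I. Then for any distinct x, y ∈ V with g₁(x) ≠ g₁(y) and g₂(x) ≠ g₂(y), the number of ordered pairs (u, v) of distinct elements of V \ {x, y} such that u shares a group with x, v shares a group with y, and u shares a group with v, is at most 24·s. -/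
open Finset


lemma aux_fst {V : Type*} [DecidableEq V] (A : Finset V) (F : V → Finset V) (s : ℝ)
    (hA : (A.card : ℝ) ≤ s) (hF : ∀ u, (F u).card ≤ 3) :
    ((A.biUnion fun u => (F u).image (fun v => (u, v))).card : ℝ) ≤ 3 * s := by
  have h : (A.biUnion fun u => (F u).image (fun v => (u, v))).card ≤ A.card * 3 :=
    Finset.card_biUnion_le_card_mul _ _ _ fun u _ => Finset.card_image_le.trans (hF u)
  have h' : ((A.biUnion fun u => (F u).image (fun v => (u, v))).card : ℝ) ≤ A.card * 3 := by
    exact_mod_cast h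
  linarith

lemma aux_snd {V : Type*} [DecidableEq V] (A : Finset V) (F : V → Finset V) (s : ℝ)
    (hA : (A.card : ℝ) ≤ s) (hF : ∀ u, (F u).card ≤ 3) :
    ((A.biUnion fun v => (F v).image (fun u => (u, v))).card : ℝ) ≤ 3 * s := by
  have h : (A.biUnion fun v => (F v).image (fun u => (u, v))).card ≤ A.card * 3 :=
    Finset.card_biUnion_le_card_mul _ _ _ fun u _ => Finset.card_image_le.trans (hF u)
  have h' : ((A.biUnion fun v => (F v).image (fun u => (u, v))).card : ℝ) ≤ A.card * 3 := by
    exact_mod_cast h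
  linarith

/-- **Potential bad pairs bound.** Let `V` be a finite set with two group assignments
`g₁ g₂ : V → I`, where every group has at most `s` members (`s ≥ 1` real) and every Type-1
group meets every Type-2 group in at most `3` elements. Say `u` *shares a group* with `w` if
`g₁ u = g₁ w` or `g₂ u = g₂ w`. Then for distinct `x, y` sharing no group, the number of
ordered pairs `(u, v)` of distinct elements of `V \ {x, y}` with `u` sharing a group with `x`,
`v` sharing a group with `y`, and `u` sharing a group with `v`, is at most `24·s`. -/
theorem potential_bad_pairs_le
    {V I : Type*} [Fintype V] [DecidableEq V] [DecidableEq I]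
    (g₁ g₂ : V → I) (s : ℝ) (hs : 1 ≤ s)
    (hsize₁ : ∀ i : I, ((Finset.univ.filter fun v : V => g₁ v = i).card : ℝ) ≤ s)
    (hsize₂ : ∀ i : I, ((Finset.univ.filter fun v : V => g₂ v = i).card : ℝ) ≤ s)
    (hint : ∀ i j : I, (Finset.univ.filter fun v : V => g₁ v = i ∧ g₂ v = j).card ≤ 3)
    (x y : V) (hxy : x ≠ y) (h₁ : g₁ x ≠ g₁ y) (h₂ : g₂ x ≠ g₂ y) :
    ((Finset.univ.filter fun p : V × V =>
        p.1 ≠ p.2 ∧ p.1 ≠ x ∧ p.1 ≠ y ∧ p.2 ≠ x ∧ p.2 ≠ y ∧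
        (g₁ p.1 = g₁ x ∨ g₂ p.1 = g₂ x) ∧
        (g₁ p.2 = g₁ y ∨ g₂ p.2 = g₂ y) ∧
        (g₁ p.1 = g₁ p.2 ∨ g₂ p.1 = g₂ p.2)).card : ℝ) ≤ 24 * s := by
  let P (i : I) : Finset V := Finset.univ.filter fun v : V => g₁ v = i
  let Q (i : I) : Finset V := Finset.univ.filter fun v : V => g₂ v = i
  let R (i j : I) : Finset V := Finset.univ.filter fun v : V => g₁ v = i ∧ g₂ v = j
  have b1 := aux_fst (P (g₁ x)) (fun u => R (g₁ y) (g₂ u)) s (hsize₁ _) (fun _ => hint _ _)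
  have b2 := aux_fst (P (g₁ x)) (fun _ => R (g₁ x) (g₂ y)) s (hsize₁ _) (fun _ => hint _ _)
  have b3 := aux_snd (Q (g₂ y)) (fun _ => R (g₁ x) (g₂ y)) s (hsize₂ _) (fun _ => hint _ _)
  have b4 := aux_fst (Q (g₂ x)) (fun u => R (g₁ u) (g₂ y)) s (hsize₂ _) (fun _ => hint _ _)
  have b5 := aux_fst (Q (g₂ x)) (fun _ => R (g₁ y) (g₂ x)) s (hsize₂ _) (fun _ => hint _ _)
  have b6 := aux_snd (P (g₁ y)) (fun _ => R (g₁ y) (g₂ x)) s (hsize₁ _) (fun _ => hint _ _)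
  set B1 := (P (g₁ x)).biUnion fun u => (R (g₁ y) (g₂ u)).image (fun v => (u, v)) with hB1
  set B2 := (P (g₁ x)).biUnion fun u => (R (g₁ x) (g₂ y)).image (fun v => (u, v)) with hB2
  set B3 := (Q (g₂ y)).biUnion fun v => (R (g₁ x) (g₂ y)).image (fun u => (u, v)) with hB3
  set B4 := (Q (g₂ x)).biUnion fun u => (R (g₁ u) (g₂ y)).image (fun v => (u, v)) with hB4
  set B5 := (Q (g₂ x)).biUnion fun u => (R (g₁ y) (g₂ x)).image (fun v => (u, v)) with hB5
  set B6 := (P (g₁ y)).biUnion fun v => (R (g₁ y) (g₂ x)).image (fun u => (u, v)) with hB6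
  have hsub : (Finset.univ.filter fun p : V × V =>
        p.1 ≠ p.2 ∧ p.1 ≠ x ∧ p.1 ≠ y ∧ p.2 ≠ x ∧ p.2 ≠ y ∧
        (g₁ p.1 = g₁ x ∨ g₂ p.1 = g₂ x) ∧
        (g₁ p.2 = g₁ y ∨ g₂ p.2 = g₂ y) ∧
        (g₁ p.1 = g₁ p.2 ∨ g₂ p.1 = g₂ p.2)) ⊆ B1 ∪ (B2 ∪ (B3 ∪ (B4 ∪ (B5 ∪ B6)))) := by
    rintro ⟨u, v⟩ hp
    simp only [Finset.mem_filter, Finset.mem_univ, true_and] at hp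
    obtain ⟨-, -, -, -, -, ha, hb, hc⟩ := hp
    have m1 : (u, v) ∈ B1 ↔ g₁ u = g₁ x ∧ g₁ v = g₁ y ∧ g₂ v = g₂ u := by
      simp [hB1, P, R]
    have m2 : (u, v) ∈ B2 ↔ g₁ u = g₁ x ∧ g₁ v = g₁ x ∧ g₂ v = g₂ y := by
      simp [hB2, P, R]
    have m3 : (u, v) ∈ B3 ↔ g₂ v = g₂ y ∧ g₁ u = g₁ x ∧ g₂ u = g₂ y := by
      simp [hB3, Q, R]
    have m4 : (u, v) ∈ B4 ↔ g₂ u = g₂ x ∧ g₁ v = g₁ u ∧ g₂ v = g₂ y := by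
      simp [hB4, Q, R]
    have m5 : (u, v) ∈ B5 ↔ g₂ u = g₂ x ∧ g₁ v = g₁ y ∧ g₂ v = g₂ x := by
      simp [hB5, Q, R]
    have m6 : (u, v) ∈ B6 ↔ g₁ v = g₁ y ∧ g₁ u = g₁ y ∧ g₂ u = g₂ x := by
      simp [hB6, P, R]
    simp only [Finset.mem_union, m1, m2, m3, m4, m5, m6]
    clear m1 m2 m3 m4 m5 m6 b1 b2 b3 b4 b5 b6
    clear_value B1 B2 B3 B4 B5 B6
    clear hB1 hB2 hB3 hB4 hB5 hB6
    clear hsize₁ hsize₂ hint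
    grind
  have hc := Finset.card_le_card hsub
  have u1 := Finset.card_union_le B1 (B2 ∪ (B3 ∪ (B4 ∪ (B5 ∪ B6))))
  have u2 := Finset.card_union_le B2 (B3 ∪ (B4 ∪ (B5 ∪ B6)))
  have u3 := Finset.card_union_le B3 (B4 ∪ (B5 ∪ B6))
  have u4 := Finset.card_union_le B4 (B5 ∪ B6)
  have u5 := Finset.card_union_le B5 B6
  have key := hc.trans (show _ ≤ B1.card + B2.card + B3.card + B4.card + B5.card + B6.card by omega)
  have key' := (Nat.cast_le (α := ℝ)).mpr key
  push_cast at key'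
  linarith
end
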